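/- Assume Σ and N are continuous on [0,T] and 2Σ(t)ΓΣ(t)ᵀ − B(t)N(t)⁻¹B(t)ᵀ is negative definite for every t ∈ [0,T]. Then there exists a unique continuous function P : [0,T] → S^{n×n} satisfying, for all t ∈ [0,T], P(t) = H + ∫_t^T [A(s)ᵀP(s) + P(s)A(s) + M(s) + P(s)(2Σ(s)ΓΣ(s)ᵀ − B(s)N(s)⁻¹B(s)ᵀ)P(s)] ds, and this solution satisfies P(t) ≥ 0 (positive semidefinite) for all t ∈ [0,T] and sup_{t∈[0,T]} ‖P(t)‖ ≤ e^{2‖A‖_∞ T}(‖H‖ + ‖M‖_∞ T). -/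

import Mathlib

open Matrix MeasureTheory intervalIntegral

attribute [local instance] Matrix.frobeniusNormedAddCommGroup Matrix.frobeniusNormedSpace

theorem norm_exp_neg_smul_integral_le {E : Type*} [NormedAddCommGroup E] [NormedSpace ℝ E]
    {g : ℝ → E} {a b L D : ℝ} (hL : 0 < L) (hab : a ≤ b)
    (hg : ∀ s, a ≤ s → ‖g s‖ ≤ D * Real.exp (L * (s - a))) :
    Real.exp (-(L * (b - a))) * ‖∫ s in a..b, g s‖ ≤ D / L := by
  have hD : 0 ≤ D := by simpa using (norm_nonneg _).trans (hg a le_rfl)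
  have hder : ∀ s ∈ Set.uIcc a b, HasDerivAt (fun s => D / L * Real.exp (L * (s - a)))
      (D * Real.exp (L * (s - a))) s := by
    intro s _
    have h := ((((hasDerivAt_id s).sub_const a).const_mul L).exp).const_mul (D / L)
    exact h.congr_deriv (by simp only [mul_one, id]; field_simp)
  have hcont : Continuous fun s => D * Real.exp (L * (s - a)) := by fun_prop
  have hint : ‖∫ s in a..b, g s‖ ≤ D / L * Real.exp (L * (b - a)) - D / L := by
    calc ‖∫ s in a..b, g s‖ ≤ ∫ s in a..b, D * Real.exp (L * (s - a)) :=
          norm_integral_le_of_norm_le hab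
            (Filter.Eventually.of_forall fun s hs => hg s hs.1.le) (hcont.intervalIntegrable _ _)
      _ = _ := by
          rw [integral_eq_sub_of_hasDerivAt hder (hcont.intervalIntegrable _ _)]
          simp
  calc Real.exp (-(L * (b - a))) * ‖∫ s in a..b, g s‖
      ≤ Real.exp (-(L * (b - a))) * (D / L * Real.exp (L * (b - a))) := by
        gcongr
        have : 0 ≤ D / L := by positivity
        linarith
    _ = D / L := by
        rw [mul_left_comm, ← Real.exp_add]
        simp

/-- Global Carathéodory existence forward in time for a globally Lipschitz vector field that is
merely measurable in time. -/
theorem exists_forward_integral_solution {E : Type*} [NormedAddCommGroup E] [NormedSpace ℝ E]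
    [CompleteSpace E] {f : ℝ → E → E} {K C : ℝ}
    (hmeas : ∀ u : ℝ → E, Continuous u → AEStronglyMeasurable (fun s => f s (u s)) volume)
    (hlip : ∀ s x y, ‖f s x - f s y‖ ≤ K * ‖x - y‖) (hbd : ∀ s, ‖f s 0‖ ≤ C) (x₀ : E) (a : ℝ) :
    ∃ x : ℝ → E, Continuous x ∧ ∀ t, a ≤ t → x t = x₀ + ∫ s in a..t, f s (x s) := by
  wlog hK : 0 < K generalizing K
  · exact this (K := 1) (fun s x y => (hlip s x y).trans (by
      gcongr; linarith)) one_pos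
  have hC : 0 ≤ C := (norm_nonneg _).trans (hbd 0)
  have hgrow : ∀ s x, ‖f s x‖ ≤ C + K * ‖x‖ := fun s x => by
    have h := norm_add_le (f s 0) (f s x - f s 0)
    have h' := hlip s x 0
    simp only [add_sub_cancel, sub_zero] at h h'
    linarith [hbd s]
  set L := 2 * K with hLdef
  have hL : 0 < L := by positivity
  let z : BoundedContinuousFunction ℝ E → ℝ → E := fun y s => Real.exp (L * (s - a)) • y s
  have hz : ∀ y, Continuous (z y) := fun y => by
    have := y.continuous
    fun_prop
  have hloc : ∀ y b c, IntervalIntegrable (fun s => f s (z y s)) volume b c := fun y b c => by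
    have hcont : Continuous fun s => C + K * ‖z y s‖ := by
      have := hz y
      fun_prop
    exact (hcont.intervalIntegrable b c).mono_fun (hmeas _ (hz y)).restrict
      (Filter.Eventually.of_forall fun s => (hgrow s _).trans (le_abs_self _))
  let F : BoundedContinuousFunction ℝ E → ℝ → E := fun y t =>
    Real.exp (-(L * (max t a - a))) • (x₀ + ∫ s in a..(max t a), f s (z y s))
  have hFcont : ∀ y, Continuous (F y) := fun y => by
    have h1 : Continuous fun t => ∫ s in a..t, f s (z y s) :=
      continuous_primitive (fun b c => hloc y b c) a
    have h2 : Continuous fun t : ℝ => max t a := by fun_prop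
    have := h1.comp h2
    simp only [Function.comp_def] at this
    fun_prop
  have hznorm : ∀ y s, ‖z y s‖ ≤ Real.exp (L * (s - a)) * ‖y‖ := fun y s => by
    simp only [z, norm_smul, Real.norm_eq_abs, Real.abs_exp]
    gcongr
    exact y.norm_coe_le_norm s
  have hFbd : ∀ y t, ‖F y t‖ ≤ ‖x₀‖ + (C + K * ‖y‖) / L := fun y t => by
    have hta : a ≤ max t a := le_max_right _ _
    have h := norm_exp_neg_smul_integral_le (g := fun s => f s (z y s)) (D := C + K * ‖y‖) hL hta
      (fun s hs => by
        have h1 : 1 ≤ Real.exp (L * (s - a)) :=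
          Real.one_le_exp (mul_nonneg hL.le (sub_nonneg.2 hs))
        have h2 := mul_le_mul_of_nonneg_left (hznorm y s) hK.le
        nlinarith [hgrow s (z y s), mul_le_mul_of_nonneg_left h1 hC])
    have h1 : Real.exp (-(L * (max t a - a))) ≤ 1 :=
      Real.exp_le_one_iff.2 (by nlinarith)
    simp only [F, norm_smul, Real.norm_eq_abs, Real.abs_exp]
    calc _ ≤ Real.exp (-(L * (max t a - a))) * (‖x₀‖ + ‖∫ s in a..(max t a), f s (z y s)‖) := by
          gcongr
          exact norm_add_le _ _
      _ ≤ _ := by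
          rw [mul_add]
          exact add_le_add (mul_le_of_le_one_left (norm_nonneg _) h1) h
  let Ψ : BoundedContinuousFunction ℝ E → BoundedContinuousFunction ℝ E := fun y =>
    BoundedContinuousFunction.ofNormedAddCommGroup (F y) (hFcont y) _ (hFbd y)
  have hΨ : ContractingWith (1 / 2) Ψ := by
    refine ⟨by norm_num, LipschitzWith.of_dist_le_mul fun y w => ?_⟩
    refine (BoundedContinuousFunction.dist_le (by positivity)).2 fun t => ?_
    have hta : a ≤ max t a := le_max_right _ _
    have h := norm_exp_neg_smul_integral_le (g := fun s => f s (z y s) - f s (z w s))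
      (D := K * dist y w) hL hta (fun s hs => by
        refine (hlip s _ _).trans ?_
        simp only [z]
        rw [← smul_sub, norm_smul, Real.norm_eq_abs, Real.abs_exp, mul_assoc K,
          mul_comm (dist y w), ← dist_eq_norm]
        gcongr
        exact BoundedContinuousFunction.dist_coe_le_dist s)
    have heq : F y t - F w t = Real.exp (-(L * (max t a - a))) •
        ∫ s in a..(max t a), (f s (z y s) - f s (z w s)) := by
      simp only [F]
      rw [integral_sub (hloc y _ _) (hloc w _ _), ← smul_sub]
      congr 1
      abel
    change dist (F y t) (F w t) ≤ _
    rw [dist_eq_norm, heq, norm_smul, Real.norm_eq_abs, Real.abs_exp]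
    refine h.trans (le_of_eq ?_)
    rw [hLdef]
    push_cast
    field_simp
  obtain ⟨y, hy, -⟩ := hΨ.exists_fixedPoint (0 : BoundedContinuousFunction ℝ E) (edist_ne_top _ _)
  refine ⟨z y, hz y, fun t ht => ?_⟩
  have hyt : y t = F y t := by
    conv_lhs => rw [← hy.eq]
    rfl
  simp only [z]
  rw [hyt]
  simp only [F, max_eq_left ht]
  rw [smul_smul, ← Real.exp_add, add_neg_cancel, Real.exp_zero, one_smul]

theorem exists_terminal_integral_solution {E : Type*} [NormedAddCommGroup E] [NormedSpace ℝ E]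
    [CompleteSpace E] {f : ℝ → E → E} {K C : ℝ}
    (hmeas : ∀ u : ℝ → E, Continuous u → AEStronglyMeasurable (fun s => f s (u s)) volume)
    (hlip : ∀ s x y, ‖f s x - f s y‖ ≤ K * ‖x - y‖) (hbd : ∀ s, ‖f s 0‖ ≤ C) (x₀ : E) (T : ℝ) :
    ∃ x : ℝ → E, Continuous x ∧ ∀ t, t ≤ T → x t = x₀ + ∫ s in t..T, f s (x s) := by
  obtain ⟨x, hx, hxeq⟩ := exists_forward_integral_solution (f := fun s => f (-s))
    (fun u hu => by
      have h := (hmeas (fun s => u (-s)) (by fun_prop)).comp_measurePreserving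
        (Measure.measurePreserving_neg (volume : Measure ℝ))
      simpa [Function.comp_def] using h)
    (fun s => hlip (-s)) (fun s => hbd (-s)) x₀ (-T)
  refine ⟨fun t => x (-t), by fun_prop, fun t ht => ?_⟩
  change x (-t) = _
  rw [hxeq (-t) (by linarith)]
  have h := integral_comp_neg (a := -T) (b := -t) (fun s => f s (x (-s)))
  simp only [neg_neg] at h
  rw [h]

/-- Grönwall's inequality in backward integral form. -/
theorem le_mul_exp_of_le_add_mul_integral {u : ℝ → ℝ} {c K T : ℝ} (hK : 0 ≤ K)
    (hu : ContinuousOn u (Set.Icc 0 T))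
    (h : ∀ t ∈ Set.Icc 0 T, u t ≤ c + K * ∫ s in t..T, u s) {t : ℝ} (ht : t ∈ Set.Icc 0 T) :
    u t ≤ c * Real.exp (K * (T - t)) := by
  have hT : (0 : ℝ) ≤ T := ht.1.trans ht.2
  have hii : IntervalIntegrable u volume 0 T := by
    apply ContinuousOn.intervalIntegrable
    rwa [Set.uIcc_of_le hT]
  have hVcont : ContinuousOn (fun t => Real.exp (K * t) * (c + K * ∫ s in t..T, u s))
      (Set.Icc 0 T) := by
    have h1 : ContinuousOn (fun t => ∫ s in t..T, u s) (Set.Icc 0 T) := by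
      have := continuousOn_primitive_interval' (b₁ := 0) (b₂ := T) (a := T) hii
        (by simp)
      rw [Set.uIcc_of_le hT] at this
      refine this.neg.congr fun t _ => ?_
      simp [integral_symm t T]
    fun_prop
  have hVmono : MonotoneOn (fun t => Real.exp (K * t) * (c + K * ∫ s in t..T, u s))
      (Set.Icc 0 T) := by
    refine monotoneOn_of_hasDerivWithinAt_nonneg (convex_Icc 0 T) hVcont
      (f' := fun t => Real.exp (K * t) * K * (c + K * ∫ s in t..T, u s) +
        Real.exp (K * t) * (K * -u t)) ?_ ?_
    · intro t ht
      rw [interior_Icc] at ht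
      have hnhds : Set.Icc 0 T ∈ nhds t := Icc_mem_nhds ht.1 ht.2
      have h1 : HasDerivAt (fun t => ∫ s in t..T, u s) (-u t) t := by
        refine integral_hasDerivAt_left (hii.mono_set ?_) ?_ (hu.continuousAt hnhds)
        · rw [Set.uIcc_of_le hT, Set.uIcc_of_le ht.2.le]
          exact Set.Icc_subset_Icc_left ht.1.le
        · exact hu.stronglyMeasurableAtFilter_nhdsWithin measurableSet_Icc t |>.filter_mono
            (by rw [nhdsWithin_eq_nhds.2 hnhds])
      have h2 := ((hasDerivAt_id t).const_mul K).exp.mul ((h1.const_mul K).const_add c)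
      rw [mul_one] at h2
      exact h2.hasDerivWithinAt
    · intro t ht
      rw [interior_Icc] at ht
      have h1 := h t (Set.Ioo_subset_Icc_self ht)
      have h2 : 0 ≤ Real.exp (K * t) * K := by positivity
      nlinarith
  have h1 := hVmono ht ⟨hT, le_rfl⟩ ht.2
  simp only [integral_same, mul_zero, add_zero] at h1
  have h2 : u t * Real.exp (K * t) ≤ Real.exp (K * T) * c := by
    refine le_trans ?_ h1
    rw [mul_comm]
    gcongr
    exact h t ht
  have h3 : Real.exp (K * T) = Real.exp (K * (T - t)) * Real.exp (K * t) := by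
    rw [← Real.exp_add]
    ring_nf
  rw [h3] at h2
  have := Real.exp_pos (K * t)
  nlinarith

theorem lipschitzOnWith_and_ae_hasDerivAt_of_eq_integral {E : Type*} [NormedAddCommGroup E]
    [NormedSpace ℝ E] [CompleteSpace E] {X f : ℝ → E} {x₀ : E} {a b c : ℝ} {C : NNReal}
    (hc : c ∈ Set.Icc a b) (hmeas : AEStronglyMeasurable f volume)
    (hf : ∀ s ∈ Set.Icc a b, ‖f s‖ ≤ C)
    (hX : ∀ t ∈ Set.Icc a b, X t = x₀ + ∫ s in c..t, f s) :
    LipschitzOnWith C X (Set.Icc a b) ∧ ∀ᵐ t, t ∈ Set.Ioo a b → HasDerivAt X (f t) t := by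
  have hab : a ≤ b := hc.1.trans hc.2
  have hii : IntervalIntegrable f volume a b := by
    refine (intervalIntegrable_const (c := (C : ℝ))).mono_fun hmeas.restrict ?_
    filter_upwards [ae_restrict_mem measurableSet_uIoc] with s hs
    rw [Set.uIoc_of_le hab] at hs
    simpa using hf s (Set.Ioc_subset_Icc_self hs)
  have hsub : ∀ {p q}, p ∈ Set.Icc a b → q ∈ Set.Icc a b → IntervalIntegrable f volume p q :=
    fun hp hq => hii.mono_set (by
      rw [Set.uIcc_of_le hab]
      exact Set.uIcc_subset_Icc hp hq)
  constructor
  · refine LipschitzOnWith.of_dist_le_mul fun s hs t ht => ?_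
    rw [hX s hs, hX t ht, dist_add_left, dist_eq_norm,
      integral_interval_sub_left (hsub hc hs) (hsub hc ht), Real.dist_eq]
    refine norm_integral_le_of_norm_le_const fun r hr => hf r ?_
    exact Set.uIcc_subset_Icc ht hs (Set.uIoc_subset_uIcc hr)
  · filter_upwards [hii.ae_hasDerivAt_integral] with t h ht
    rw [Set.uIcc_of_le hab] at h
    refine ((h (Set.Ioo_subset_Icc_self ht) c hc).const_add x₀).congr_of_eventuallyEq ?_
    filter_upwards [Icc_mem_nhds ht.1 ht.2] with r hr using hX r hr

theorem norm_radial_truncation_sub_le {E : Type*} [NormedAddCommGroup E] [NormedSpace ℝ E] {R : ℝ}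
    (hR : 0 < R) (x y : E) :
    ‖(R / max R ‖x‖) • x - (R / max R ‖y‖) • y‖ ≤ 2 * ‖x - y‖ := by
  have hx : 0 < max R ‖x‖ := hR.trans_le (le_max_left _ _)
  have hy : 0 < max R ‖y‖ := hR.trans_le (le_max_left _ _)
  have heq : (R / max R ‖x‖) • x - (R / max R ‖y‖) • y =
      (R / max R ‖x‖) • (x - y) + (R / max R ‖x‖ - R / max R ‖y‖) • y := by
    rw [smul_sub, sub_smul]
    abel
  have h1 : R / max R ‖x‖ ≤ 1 := (div_le_one hx).2 (le_max_left _ _)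
  have h1' : 0 ≤ R / max R ‖x‖ := by positivity
  have h2 : ‖y‖ / max R ‖y‖ ≤ 1 := (div_le_one hy).2 (le_max_right _ _)
  have h3 : |max R ‖y‖ - max R ‖x‖| ≤ ‖x - y‖ := by
    rw [max_comm R, max_comm R]
    refine (abs_max_sub_max_le_abs _ _ _).trans ?_
    rw [norm_sub_rev]
    exact abs_norm_sub_norm_le _ _
  have h4 : |R / max R ‖x‖ - R / max R ‖y‖| * ‖y‖ =
      (R / max R ‖x‖) * (‖y‖ / max R ‖y‖) * |max R ‖y‖ - max R ‖x‖| := by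
    have : R / max R ‖x‖ - R / max R ‖y‖ =
        R / max R ‖x‖ * (1 / max R ‖y‖) * (max R ‖y‖ - max R ‖x‖) := by
      field_simp
    rw [this, abs_mul, abs_of_nonneg (by positivity)]
    ring
  rw [heq]
  refine (norm_add_le _ _).trans ?_
  rw [norm_smul, norm_smul, Real.norm_eq_abs, Real.norm_eq_abs, h4, abs_of_nonneg h1', two_mul]
  refine add_le_add (mul_le_of_le_one_left (norm_nonneg _) h1) ?_
  calc _ ≤ 1 * |max R ‖y‖ - max R ‖x‖| := by
        gcongr
        exact mul_le_one₀ h1 (by positivity) h2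
    _ ≤ _ := by rwa [one_mul]

theorem norm_radial_truncation_le {E : Type*} [NormedAddCommGroup E] [NormedSpace ℝ E] {R : ℝ}
    (hR : 0 < R) (x : E) : ‖(R / max R ‖x‖) • x‖ ≤ R := by
  have hx : 0 < max R ‖x‖ := hR.trans_le (le_max_left _ _)
  rw [norm_smul, Real.norm_of_nonneg (by positivity), div_mul_eq_mul_div]
  exact div_le_of_le_mul₀ hx.le hR.le (by gcongr; exact le_max_right _ _)

theorem eqOn_of_eq_integral_of_norm_sub_le {E : Type*} [NormedAddCommGroup E] [NormedSpace ℝ E]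
    {x y f g : ℝ → E} {x₀ : E} {K T : ℝ} (hK : 0 ≤ K) (hx : ContinuousOn x (Set.Icc 0 T))
    (hy : ContinuousOn y (Set.Icc 0 T)) (hf : IntervalIntegrable f volume 0 T)
    (hg : IntervalIntegrable g volume 0 T)
    (hxf : ∀ t ∈ Set.Icc 0 T, x t = x₀ + ∫ s in t..T, f s)
    (hyg : ∀ t ∈ Set.Icc 0 T, y t = x₀ + ∫ s in t..T, g s)
    (h : ∀ s ∈ Set.Icc 0 T, ‖f s - g s‖ ≤ K * ‖x s - y s‖) :
    Set.EqOn x y (Set.Icc 0 T) := by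
  intro t ht
  have hcont : ContinuousOn (fun t => ‖x t - y t‖) (Set.Icc 0 T) := (hx.sub hy).norm
  have hle := le_mul_exp_of_le_add_mul_integral (c := 0) hK hcont (fun t ht => by
    have hsub : Set.uIcc t T ⊆ Set.uIcc 0 T := by
      rw [Set.uIcc_of_le ht.2, Set.uIcc_of_le (ht.1.trans ht.2)]
      exact Set.Icc_subset_Icc_left ht.1
    have hci : IntervalIntegrable (fun t => K * ‖x t - y t‖) volume t T := by
      apply ContinuousOn.intervalIntegrable
      rw [Set.uIcc_of_le ht.2]
      exact (hcont.mono (Set.Icc_subset_Icc_left ht.1)).const_smul K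
    rw [hxf t ht, hyg t ht, add_sub_add_left_eq_sub,
      ← integral_sub (hf.mono_set hsub) (hg.mono_set hsub), zero_add,
      ← intervalIntegral.integral_const_mul]
    exact norm_integral_le_of_norm_le ht.2
      (Filter.Eventually.of_forall fun s hs => h s ⟨ht.1.trans hs.1.le, hs.2⟩) hci) ht
  rw [zero_mul] at hle
  exact sub_eq_zero.1 (norm_le_zero_iff.1 hle)

theorem LipschitzOnWith.mul_of_norm_le {α R : Type*} [PseudoMetricSpace α] [NormedRing R]
    {f g : α → R} {s : Set α} {Kf Kg p q : NNReal} (hf : LipschitzOnWith Kf f s)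
    (hg : LipschitzOnWith Kg g s) (hfp : ∀ x ∈ s, ‖f x‖ ≤ p) (hgq : ∀ x ∈ s, ‖g x‖ ≤ q) :
    LipschitzOnWith (Kf * q + p * Kg) (fun x => f x * g x) s := by
  refine LipschitzOnWith.of_dist_le_mul fun x hx y hy => ?_
  have h1 := hf.dist_le_mul x hx y hy
  have h2 := hg.dist_le_mul x hx y hy
  rw [dist_eq_norm] at h1 h2 ⊢
  have heq : f x * g x - f y * g y = (f x - f y) * g x + f y * (g x - g y) := by noncomm_ring
  rw [heq]
  push_cast
  calc _ ≤ ‖f x - f y‖ * ‖g x‖ + ‖f y‖ * ‖g x - g y‖ :=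
        (norm_add_le _ _).trans (add_le_add (norm_mul_le _ _) (norm_mul_le _ _))
    _ ≤ (Kf * dist x y) * q + p * (Kg * dist x y) := by
        gcongr
        · exact hgq x hx
        · exact hfp y hy
    _ = _ := by ring

theorem AbsolutelyContinuousOnInterval.le_of_ae_hasDerivAt_nonpos {φ φ' : ℝ → ℝ} {a b : ℝ}
    (hab : a ≤ b) (hφ : AbsolutelyContinuousOnInterval φ a b)
    (hder : ∀ᵐ t, t ∈ Set.Ioo a b → HasDerivAt φ (φ' t) t)
    (hnonpos : ∀ t ∈ Set.Ioo a b, φ' t ≤ 0) : φ b ≤ φ a := by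
  rw [← sub_nonpos, ← hφ.integral_deriv_eq_sub, integral_of_le hab,
    integral_Ioc_eq_integral_Ioo]
  refine setIntegral_nonpos_ae measurableSet_Ioo ?_
  filter_upwards [hder] with t ht hmem
  rw [(ht hmem).deriv]
  exact hnonpos t hmem

open scoped MatrixOrder ComplexOrder in
theorem Matrix.PosSemidef.exists_eq_conjTranspose_mul_self {n : ℕ}
    {P : Matrix (Fin n) (Fin n) ℝ} (hP : P.PosSemidef) : ∃ B, P = Bᴴ * B :=
  (CStarAlgebra.nonneg_iff_eq_star_mul_self (A := Matrix (Fin n) (Fin n) ℝ)).1 hP.nonneg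

section MatrixEquations

attribute [local instance] Matrix.frobeniusNormedRing Matrix.frobeniusNormedAlgebra

/-- The uniformity of the Frobenius norm, given precedence below over the entrywise one. -/
noncomputable abbrev Matrix.frobeniusUniformSpace {n : ℕ} : UniformSpace (Matrix (Fin n) (Fin n) ℝ) :=
  PseudoMetricSpace.toUniformSpace

/-- The topology of the Frobenius norm, given precedence below over the entrywise one. -/
noncomputable abbrev Matrix.frobeniusTopologicalSpace {n : ℕ} :
    TopologicalSpace (Matrix (Fin n) (Fin n) ℝ) :=
  UniformSpace.toTopologicalSpace (self := PseudoMetricSpace.toUniformSpace)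

attribute [local instance] Matrix.frobeniusUniformSpace Matrix.frobeniusTopologicalSpace

theorem Matrix.PosSemidef.frobenius_norm_le_of_sub {n : ℕ} {P Q : Matrix (Fin n) (Fin n) ℝ}
    (hP : P.PosSemidef) (hQP : (Q - P).PosSemidef) : ‖P‖ ≤ ‖Q‖ := by
  have hsq : ∀ X : Matrix (Fin n) (Fin n) ℝ, ‖X‖ ^ 2 = (Xᵀ * X).trace := fun X => by
    rw [frobenius_norm_def, ← Real.sqrt_eq_rpow, Real.sq_sqrt (by positivity), trace,
      Finset.sum_comm]
    simp [mul_apply, pow_two]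
  obtain ⟨D, rfl⟩ : ∃ D, Q = P + D := ⟨Q - P, by abel⟩
  rw [add_sub_cancel_left] at hQP
  have htr : 0 ≤ (P * D).trace := by
    obtain ⟨B, rfl⟩ := hP.exists_eq_conjTranspose_mul_self
    rw [mul_assoc, trace_mul_comm]
    exact (hQP.mul_mul_conjTranspose_same B).trace_nonneg
  have hPt : Pᵀ = P := by simpa using hP.1.eq
  have hDt : Dᵀ = D := by simpa using hQP.1.eq
  refine le_of_sq_le_sq ?_ (norm_nonneg _)
  have hD : 0 ≤ ‖D‖ ^ 2 := by positivity
  rw [hsq] at hD ⊢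
  rw [hsq, transpose_add, hPt]
  rw [hDt] at *
  simp only [add_mul, mul_add, trace_add]
  rw [trace_mul_comm D P]
  linarith

theorem aestronglyMeasurable_lyapunov {n : ℕ} {G M Y : ℝ → Matrix (Fin n) (Fin n) ℝ}
    (hG : AEStronglyMeasurable G volume) (hM : AEStronglyMeasurable M volume)
    (hY : Continuous Y) :
    AEStronglyMeasurable (fun s => (G s)ᵀ * Y s + Y s * G s + M s) volume := by
  have hGt : AEStronglyMeasurable (fun s => (G s)ᵀ) volume :=
    (continuous_id.matrix_transpose).comp_aestronglyMeasurable hG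
  have hYm : AEStronglyMeasurable Y volume := hY.aestronglyMeasurable
  exact ((hGt.mul hYm).add (hYm.mul hG)).add hM

theorem lyapunov_posSemidef {n : ℕ} {T g m : ℝ} {G M Y : ℝ → Matrix (Fin n) (Fin n) ℝ}
    {H : Matrix (Fin n) (Fin n) ℝ}
    (hG : AEStronglyMeasurable G volume) (hM : AEStronglyMeasurable M volume)
    (hGbd : ∀ s, ‖G s‖ ≤ g) (hMbd : ∀ s, ‖M s‖ ≤ m)
    (hMpos : ∀ s ∈ Set.Icc 0 T, (M s).PosSemidef)
    (hH : H.PosSemidef) (hY : Continuous Y) (hYsymm : ∀ t ∈ Set.Icc 0 T, (Y t).IsSymm)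
    (heq : ∀ t ∈ Set.Icc 0 T, Y t = H + ∫ s in t..T, ((G s)ᵀ * Y s + Y s * G s + M s))
    {t : ℝ} (ht : t ∈ Set.Icc 0 T) : (Y t).PosSemidef := by
  have : CompleteSpace (Matrix (Fin n) (Fin n) ℝ) := FiniteDimensional.complete ℝ _
  refine .of_dotProduct_mulVec_nonneg (by simpa [IsHermitian] using (hYsymm t ht).eq) fun v => ?_
  obtain ⟨Φ, hΦ, hΦeq⟩ := exists_forward_integral_solution (f := fun s X => G s * X) (K := g)
    (C := 0) (fun u hu => hG.mul hu.aestronglyMeasurable)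
    (fun s X Z => by
      rw [← mul_sub]
      exact (frobenius_norm_mul _ _).trans (by gcongr; exact hGbd s)) (by simp) 1 t
  have hΦt : Φ t = 1 := by simpa using hΦeq t le_rfl
  obtain ⟨p, hp⟩ := isCompact_Icc.exists_bound_of_continuousOn (s := Set.Icc t T) hΦ.continuousOn
  obtain ⟨q, hq⟩ := isCompact_Icc.exists_bound_of_continuousOn (s := Set.Icc t T) hY.continuousOn
  have hp0 : 0 ≤ p := (norm_nonneg _).trans (hp t ⟨le_rfl, ht.2⟩)
  have hq0 : 0 ≤ q := (norm_nonneg _).trans (hq t ⟨le_rfl, ht.2⟩)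
  have hg0 : 0 ≤ g := (norm_nonneg _).trans (hGbd 0)
  have hm0 : 0 ≤ m := (norm_nonneg _).trans (hMbd 0)
  obtain ⟨hΦlip, hΦder⟩ := lipschitzOnWith_and_ae_hasDerivAt_of_eq_integral (X := Φ)
    (f := fun s => G s * Φ s) (x₀ := 1) (a := t) (b := T) (c := t)
    (C := ⟨g * p, by positivity⟩) ⟨le_rfl, ht.2⟩
    (hG.mul hΦ.aestronglyMeasurable) (fun s hs => (frobenius_norm_mul _ _).trans
      (mul_le_mul (hGbd s) (hp s hs) (norm_nonneg _) hg0)) (fun s hs => hΦeq s hs.1)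
  obtain ⟨hYlip, hYder⟩ := lipschitzOnWith_and_ae_hasDerivAt_of_eq_integral (X := Y)
    (f := fun s => -((G s)ᵀ * Y s + Y s * G s + M s)) (x₀ := H) (a := t) (b := T) (c := T)
    (C := ⟨g * q + q * g + m, by positivity⟩) ⟨ht.2, le_rfl⟩
    (aestronglyMeasurable_lyapunov hG hM hY).neg (fun s hs => by
      rw [norm_neg]
      refine norm_add₃_le.trans (add_le_add (add_le_add ?_ ?_) (hMbd s))
      · refine (frobenius_norm_mul _ _).trans (mul_le_mul ?_ (hq s hs) (norm_nonneg _) hg0)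
        rw [frobenius_norm_transpose]
        exact hGbd s
      · exact (frobenius_norm_mul _ _).trans (mul_le_mul (hq s hs) (hGbd s) (norm_nonneg _) hq0))
    (fun s hs => by
      rw [heq s ⟨ht.1.trans hs.1, hs.2⟩, intervalIntegral.integral_neg, ← integral_symm])
  have hΦtlip : LipschitzOnWith ⟨g * p, by positivity⟩ (fun s => (Φ s)ᵀ) (Set.Icc t T) := by
    refine LipschitzOnWith.of_dist_le_mul fun x hx y hy => ?_
    rw [dist_eq_norm, ← transpose_sub, frobenius_norm_transpose, ← dist_eq_norm]
    exact hΦlip.dist_le_mul x hx y hy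
  have hlip := (hΦtlip.mul_of_norm_le (p := ⟨p, hp0⟩) (q := ⟨q, hq0⟩) hYlip
    (fun s hs => (frobenius_norm_transpose (Φ s)).trans_le (hp s hs)) hq).mul_of_norm_le
    (p := ⟨p * q, by positivity⟩) (q := ⟨p, hp0⟩) hΦlip
    (fun s hs => (frobenius_norm_mul _ _).trans (mul_le_mul
      ((frobenius_norm_transpose (Φ s)).trans_le (hp s hs)) (hq s hs) (norm_nonneg _) hp0)) hp
  let ℓ : Matrix (Fin n) (Fin n) ℝ →L[ℝ] ℝ := LinearMap.toContinuousLinearMap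
    { toFun := fun W => v ⬝ᵥ (W *ᵥ v)
      map_add' := fun W Z => by rw [add_mulVec, dotProduct_add]
      map_smul' := fun r W => by rw [smul_mulVec, dotProduct_smul]; rfl }
  have hℓ : ∀ W, ℓ W = v ⬝ᵥ (W *ᵥ v) := fun W => rfl
  let τ : Matrix (Fin n) (Fin n) ℝ →L[ℝ] Matrix (Fin n) (Fin n) ℝ :=
    LinearMap.toContinuousLinearMap (transposeLinearEquiv (Fin n) (Fin n) ℝ ℝ).toLinearMap
  have hac : AbsolutelyContinuousOnInterval (fun s => ℓ ((Φ s)ᵀ * Y s * Φ s)) t T := by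
    refine LipschitzOnWith.absolutelyContinuousOnInterval (K := ?_) ?_
    rotate_left
    · rw [Set.uIcc_of_le ht.2]
      exact ℓ.lipschitz.comp_lipschitzOnWith hlip
  have hder : ∀ᵐ s, s ∈ Set.Ioo t T → HasDerivAt (fun s => ℓ ((Φ s)ᵀ * Y s * Φ s))
      (-ℓ ((Φ s)ᵀ * M s * Φ s)) s := by
    filter_upwards [hΦder, hYder] with s h1 h2 hs
    have h3 : HasDerivAt (fun s => (Φ s)ᵀ) (G s * Φ s)ᵀ s :=
      τ.hasFDerivAt.comp_hasDerivAt s (h1 hs)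
    have h4 := ℓ.hasFDerivAt.comp_hasDerivAt s ((h3.mul (h2 hs)).mul (h1 hs))
    refine h4.congr_deriv ?_
    rw [← map_neg]
    congr 1
    rw [transpose_mul]
    simp only [Pi.mul_apply]
    noncomm_ring
  have hle := hac.le_of_ae_hasDerivAt_nonpos ht.2 hder fun s hs => by
    rw [neg_nonpos, hℓ]
    simpa using ((hMpos s ⟨ht.1.trans hs.1.le, hs.2.le⟩).conjTranspose_mul_mul_same
      (Φ s)).dotProduct_mulVec_nonneg v
  have hYT : Y T = H := by simpa using heq T ⟨ht.1.trans ht.2, le_rfl⟩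
  simp only [hΦt, hYT, transpose_one, one_mul, mul_one] at hle
  have hend : 0 ≤ ℓ ((Φ T)ᵀ * H * Φ T) := by
    rw [hℓ]
    simpa using (hH.conjTranspose_mul_mul_same (Φ T)).dotProduct_mulVec_nonneg v
  simpa [hℓ] using hend.trans hle

theorem norm_lyapunov_le {n : ℕ} {a : ℝ} {A X : Matrix (Fin n) (Fin n) ℝ} (hA : ‖A‖ ≤ a) :
    ‖Aᵀ * X + X * A‖ ≤ 2 * a * ‖X‖ := by
  have h1 : ‖Aᵀ * X‖ ≤ a * ‖X‖ := (frobenius_norm_mul _ _).trans (by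
    rw [frobenius_norm_transpose]
    gcongr)
  have h2 : ‖X * A‖ ≤ ‖X‖ * a := (frobenius_norm_mul _ _).trans (by gcongr)
  linarith [norm_add_le (Aᵀ * X) (X * A)]

theorem norm_quadratic_sub_le {n : ℕ} {σ r : ℝ} {S X Y : Matrix (Fin n) (Fin n) ℝ}
    (hS : ‖S‖ ≤ σ) (hX : ‖X‖ ≤ r) (hY : ‖Y‖ ≤ r) :
    ‖X * S * X - Y * S * Y‖ ≤ 2 * (σ * r) * ‖X - Y‖ := by
  have hσ : 0 ≤ σ := (norm_nonneg _).trans hS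
  have hr : 0 ≤ r := (norm_nonneg _).trans hX
  have heq : X * S * X - Y * S * Y = (X - Y) * (S * X) + (Y * S) * (X - Y) := by noncomm_ring
  have h1 : ‖(X - Y) * (S * X)‖ ≤ ‖X - Y‖ * (σ * r) := by
    refine (frobenius_norm_mul _ _).trans ?_
    gcongr
    exact (frobenius_norm_mul _ _).trans (by gcongr)
  have h2 : ‖(Y * S) * (X - Y)‖ ≤ r * σ * ‖X - Y‖ := by
    refine (frobenius_norm_mul _ _).trans ?_
    gcongr
    exact (frobenius_norm_mul _ _).trans (by gcongr)
  rw [heq]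
  linarith [norm_add_le ((X - Y) * (S * X)) ((Y * S) * (X - Y))]

theorem norm_quadratic_le {n : ℕ} {σ r : ℝ} {S X : Matrix (Fin n) (Fin n) ℝ}
    (hS : ‖S‖ ≤ σ) (hX : ‖X‖ ≤ r) : ‖X * S * X‖ ≤ r * σ * r := by
  have hσ : 0 ≤ σ := (norm_nonneg _).trans hS
  have hr : 0 ≤ r := (norm_nonneg _).trans hX
  refine (frobenius_norm_mul _ _).trans ?_
  gcongr
  exact (frobenius_norm_mul _ _).trans (by gcongr)

theorem intervalIntegrable_riccati {n : ℕ} {T a m σ : ℝ} (hT : 0 ≤ T)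
    {A M S X Z : ℝ → Matrix (Fin n) (Fin n) ℝ}
    (hA : AEStronglyMeasurable A volume) (hM : AEStronglyMeasurable M volume)
    (hS : AEStronglyMeasurable S volume) (hAbd : ∀ s, ‖A s‖ ≤ a) (hMbd : ∀ s, ‖M s‖ ≤ m)
    (hSbd : ∀ s, ‖S s‖ ≤ σ) (hX : ContinuousOn X (Set.Icc 0 T))
    (hZ : ContinuousOn Z (Set.Icc 0 T)) :
    IntervalIntegrable (fun s => (A s)ᵀ * X s + X s * A s + M s - Z s * S s * Z s)
      volume 0 T := by
  have hle : volume.restrict (Set.Ioc 0 T) ≤ volume.restrict (Set.Icc 0 T) :=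
    Measure.restrict_mono Set.Ioc_subset_Icc_self le_rfl
  have hXm := (hX.aestronglyMeasurable measurableSet_Icc (μ := volume)).mono_measure hle
  have hZm := (hZ.aestronglyMeasurable measurableSet_Icc (μ := volume)).mono_measure hle
  have hAt : AEStronglyMeasurable (fun s => (A s)ᵀ) volume :=
    (continuous_id.matrix_transpose).comp_aestronglyMeasurable hA
  obtain ⟨p, hp⟩ := isCompact_Icc.exists_bound_of_continuousOn hX
  obtain ⟨q, hq⟩ := isCompact_Icc.exists_bound_of_continuousOn hZ
  have ha : 0 ≤ a := (norm_nonneg _).trans (hAbd 0)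
  refine (intervalIntegrable_const (c := 2 * a * p + m + q * σ * q)).mono_fun ?_ ?_
  · rw [Set.uIoc_of_le hT]
    exact (((hAt.restrict.mul hXm).add (hXm.mul hA.restrict)).add hM.restrict).sub
      ((hZm.mul hS.restrict).mul hZm)
  · filter_upwards [ae_restrict_mem measurableSet_uIoc] with s hs
    rw [Set.uIoc_of_le hT] at hs
    have hs' := Set.Ioc_subset_Icc_self hs
    refine le_trans ?_ (le_abs_self _)
    refine (norm_sub_le _ _).trans (add_le_add ((norm_add_le _ _).trans
      (add_le_add ((norm_lyapunov_le (hAbd s)).trans ?_) (hMbd s)))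
      (norm_quadratic_le (hSbd s) (hq s hs')))
    gcongr
    exact hp s hs'

theorem continuous_radial_truncation {E : Type*} [NormedAddCommGroup E] [NormedSpace ℝ E] {R : ℝ}
    (hR : 0 < R) {X : ℝ → E} (hX : Continuous X) :
    Continuous fun s => (R / max R ‖X s‖) • X s := by
  have h : ∀ s, max R ‖X s‖ ≠ 0 := fun s => (hR.trans_le (le_max_left _ _)).ne'
  exact (continuous_const.div (continuous_const.max hX.norm) h).smul hX

theorem exists_truncated_riccati_solution {n : ℕ} {T a m σ R : ℝ} (hT : 0 ≤ T) (hR : 0 < R)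
    {A M S : ℝ → Matrix (Fin n) (Fin n) ℝ} {H : Matrix (Fin n) (Fin n) ℝ}
    (hA : AEStronglyMeasurable A volume) (hM : AEStronglyMeasurable M volume)
    (hS : AEStronglyMeasurable S volume) (hAbd : ∀ s, ‖A s‖ ≤ a) (hMbd : ∀ s, ‖M s‖ ≤ m)
    (hSbd : ∀ s, ‖S s‖ ≤ σ) (hMsymm : ∀ s, (M s).IsSymm) (hSsymm : ∀ s, (S s).IsSymm)
    (hH : H.IsSymm) :
    ∃ P : ℝ → Matrix (Fin n) (Fin n) ℝ, Continuous P ∧ (∀ t ∈ Set.Icc 0 T, (P t).IsSymm) ∧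
      ∀ t ≤ T, P t = H + ∫ s in t..T, ((A s)ᵀ * P s + P s * A s + M s -
        ((R / max R ‖P s‖) • P s) * S s * ((R / max R ‖P s‖) • P s)) := by
  have : CompleteSpace (Matrix (Fin n) (Fin n) ℝ) := FiniteDimensional.complete ℝ _
  have ha : 0 ≤ a := (norm_nonneg _).trans (hAbd 0)
  have hσ : 0 ≤ σ := (norm_nonneg _).trans (hSbd 0)
  have hAt : AEStronglyMeasurable (fun s => (A s)ᵀ) volume :=
    (continuous_id.matrix_transpose).comp_aestronglyMeasurable hA
  let f : ℝ → Matrix (Fin n) (Fin n) ℝ → Matrix (Fin n) (Fin n) ℝ := fun s X =>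
    (A s)ᵀ * X + X * A s + M s - ((R / max R ‖X‖) • X) * S s * ((R / max R ‖X‖) • X)
  have hmeas : ∀ u : ℝ → Matrix (Fin n) (Fin n) ℝ, Continuous u →
      AEStronglyMeasurable (fun s => f s (u s)) volume := fun u hu => by
    have hu' := hu.aestronglyMeasurable (μ := volume)
    have hv := (continuous_radial_truncation hR hu).aestronglyMeasurable (μ := volume)
    exact (((hAt.mul hu').add (hu'.mul hA)).add hM).sub ((hv.mul hS).mul hv)
  have hlip : ∀ s X Y, ‖f s X - f s Y‖ ≤ (2 * a + 2 * (σ * R) * 2) * ‖X - Y‖ := by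
    intro s X Y
    have heq : f s X - f s Y = ((A s)ᵀ * (X - Y) + (X - Y) * A s) -
        (((R / max R ‖X‖) • X) * S s * ((R / max R ‖X‖) • X) -
          ((R / max R ‖Y‖) • Y) * S s * ((R / max R ‖Y‖) • Y)) := by
      simp only [f, mul_sub, sub_mul]
      abel
    have h1 := norm_lyapunov_le (X := X - Y) (hAbd s)
    have h2 := norm_quadratic_sub_le (hSbd s) (norm_radial_truncation_le hR X)
      (norm_radial_truncation_le hR Y)
    have h3 := mul_le_mul_of_nonneg_left (norm_radial_truncation_sub_le hR X Y)
      (show 0 ≤ 2 * (σ * R) by positivity)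
    rw [heq]
    refine (norm_sub_le _ _).trans ?_
    linarith
  have hbd : ∀ s, ‖f s 0‖ ≤ m := fun s => by simpa [f] using hMbd s
  obtain ⟨P, hP, hPeq⟩ := exists_terminal_integral_solution hmeas hlip hbd H T
  refine ⟨P, hP, fun t ht => ?_, hPeq⟩
  have hPt : Continuous fun s => (P s)ᵀ := hP.matrix_transpose
  have hint : ∀ u : ℝ → Matrix (Fin n) (Fin n) ℝ, Continuous u →
      IntervalIntegrable (fun s => f s (u s)) volume 0 T := fun u hu =>
    intervalIntegrable_riccati hT hA hM hS hAbd hMbd hSbd hu.continuousOn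
      (continuous_radial_truncation hR hu).continuousOn
  let τ : Matrix (Fin n) (Fin n) ℝ →L[ℝ] Matrix (Fin n) (Fin n) ℝ :=
    LinearMap.toContinuousLinearMap (transposeLinearEquiv (Fin n) (Fin n) ℝ ℝ).toLinearMap
  have hτ : ∀ X, τ X = Xᵀ := fun X => rfl
  have hequiv : ∀ s X, τ (f s X) = f s Xᵀ := fun s X => by
    simp only [hτ, f, transpose_sub, transpose_add, transpose_mul, transpose_smul,
      transpose_transpose, frobenius_norm_transpose, (hMsymm s).eq, (hSsymm s).eq, mul_assoc]
    abel
  refine eqOn_of_eq_integral_of_norm_sub_le (K := 2 * a + 2 * (σ * R) * 2) (by positivity)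
    hPt.continuousOn hP.continuousOn (hint _ hPt) (hint _ hP) (fun t ht => ?_)
    (fun t ht => hPeq t ht.2) (fun s _ => hlip s _ _) ht
  have hsub : IntervalIntegrable (fun s => f s (P s)) volume t T := (hint P hP).mono_set (by
    rw [Set.uIcc_of_le ht.2, Set.uIcc_of_le hT]
    exact Set.Icc_subset_Icc_left ht.1)
  have h := τ.intervalIntegral_comp_comm hsub
  simp only [hequiv] at h
  rw [h, hτ]
  conv_lhs => rw [hPeq t ht.2, transpose_add, hH.eq]

theorem exists_riccati_solution {n : ℕ} {T a m σ : ℝ} (hT : 0 ≤ T)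
    {A M S : ℝ → Matrix (Fin n) (Fin n) ℝ} {H : Matrix (Fin n) (Fin n) ℝ}
    (hA : AEStronglyMeasurable A volume) (hM : AEStronglyMeasurable M volume)
    (hS : AEStronglyMeasurable S volume) (hAbd : ∀ s, ‖A s‖ ≤ a) (hMbd : ∀ s, ‖M s‖ ≤ m)
    (hSbd : ∀ s, ‖S s‖ ≤ σ) (hMpos : ∀ s, (M s).PosSemidef) (hSpos : ∀ s, (S s).PosSemidef)
    (hH : H.PosSemidef) :
    ∃ P : ℝ → Matrix (Fin n) (Fin n) ℝ, Continuous P ∧ (∀ t ∈ Set.Icc 0 T, (P t).PosSemidef) ∧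
      (∀ t ∈ Set.Icc 0 T, ‖P t‖ ≤ Real.exp (2 * a * T) * (‖H‖ + m * T)) ∧
      ∀ t ∈ Set.Icc 0 T, P t = H + ∫ s in t..T, ((A s)ᵀ * P s + P s * A s + M s -
        P s * S s * P s) := by
  have hsymm : ∀ {X : Matrix (Fin n) (Fin n) ℝ}, X.PosSemidef → X.IsSymm := fun hX => by
    simpa [IsSymm, IsHermitian] using hX.1
  have ha : 0 ≤ a := (norm_nonneg _).trans (hAbd 0)
  have hm : 0 ≤ m := (norm_nonneg _).trans (hMbd 0)
  have hσ : 0 ≤ σ := (norm_nonneg _).trans (hSbd 0)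
  set R₀ := Real.exp (2 * a * T) * (‖H‖ + m * T) with hR₀
  set R := R₀ + 1
  have hR₀nonneg : 0 ≤ R₀ := by positivity
  have hR : 0 < R := by positivity
  obtain ⟨Q, hQ, hQsymm, hQeq⟩ := exists_truncated_riccati_solution hT hR hA hM
    (S := 0) aestronglyMeasurable_const hAbd hMbd (σ := 0) (by simp) (fun s => hsymm (hMpos s))
    (fun s => by simp [IsSymm]) (hsymm hH)
  obtain ⟨P, hP, hPsymm, hPeq⟩ := exists_truncated_riccati_solution hT hR hA hM hS hAbd hMbd hSbd
    (fun s => hsymm (hMpos s)) (fun s => hsymm (hSpos s)) (hsymm hH)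
  simp only [Pi.zero_apply, mul_zero, zero_mul, sub_zero] at hQeq
  have hsub : ∀ {t}, t ∈ Set.Icc 0 T → Set.uIcc t T ⊆ Set.uIcc 0 T := fun ht => by
    rw [Set.uIcc_of_le ht.2, Set.uIcc_of_le hT]
    exact Set.Icc_subset_Icc_left ht.1
  set c : ℝ → ℝ := fun s => R / max R ‖P s‖ with hc
  have hcP : Continuous fun s => c s • P s := continuous_radial_truncation hR hP
  have hcPbd : ∀ s, ‖c s • P s‖ ≤ R := fun s => norm_radial_truncation_le hR (P s)
  have hmax : ∀ s, 0 < max R ‖P s‖ := fun s => hR.trans_le (le_max_left _ _)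
  have hccont : Continuous c := continuous_const.div (continuous_const.max hP.norm)
    fun s => (hmax s).ne'
  have hc0 : ∀ s, 0 ≤ c s := fun s => div_nonneg hR.le (hmax s).le
  have hc1 : ∀ s, c s ≤ 1 := fun s => (div_le_one (hmax s)).2 (le_max_left _ _)
  have hPint := intervalIntegrable_riccati hT hA hM hS hAbd hMbd hSbd hP.continuousOn
    hcP.continuousOn
  have hQint := intervalIntegrable_riccati hT hA hM (S := 0) (Z := 0) aestronglyMeasurable_const
    hAbd hMbd (σ := 0) (by simp) hQ.continuousOn continuousOn_const
  simp only [Pi.zero_apply, mul_zero, sub_zero] at hQint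
  have hPpos : ∀ t ∈ Set.Icc 0 T, (P t).PosSemidef := fun t ht => by
    refine lyapunov_posSemidef (G := fun s => A s - (c s / 2) • (S s * (c s • P s)))
      (g := a + σ * R) (m := m) ?_ hM ?_ hMbd (fun s _ => hMpos s) hH hP hPsymm ?_ ht
    · exact hA.sub ((hccont.div_const 2).aestronglyMeasurable.smul
        (hS.mul hcP.aestronglyMeasurable))
    · intro s
      refine (norm_sub_le _ _).trans (add_le_add (hAbd s) ?_)
      have h1 : ‖S s * (c s • P s)‖ ≤ σ * R := (frobenius_norm_mul _ _).trans
        (mul_le_mul (hSbd s) (hcPbd s) (norm_nonneg _) hσ)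
      rw [norm_smul, Real.norm_of_nonneg (by linarith [hc0 s])]
      exact (mul_le_of_le_one_left (norm_nonneg _) (by linarith [hc1 s])).trans h1
    · intro t ht
      rw [hPeq t ht.2]
      congr 1
      refine integral_congr fun s hs => ?_
      rw [Set.uIcc_of_le ht.2] at hs
      have h1 := hPsymm s ⟨ht.1.trans hs.1, hs.2⟩
      have h2 := hsymm (hSpos s)
      simp only [transpose_sub, transpose_smul, transpose_mul, h1.eq, h2.eq, sub_mul, mul_sub,
        smul_mul_assoc, mul_smul_comm, smul_smul, ← mul_assoc]
      module
  have hQPpos : ∀ t ∈ Set.Icc 0 T, (Q t - P t).PosSemidef := fun t ht => by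
    refine lyapunov_posSemidef (Y := fun t => Q t - P t) (G := A) (H := 0) (g := a)
      (M := fun s => (c s • P s) * S s * (c s • P s)) (m := R * σ * R) hA ?_ hAbd
      (fun s => norm_quadratic_le (hSbd s) (hcPbd s)) ?_ PosSemidef.zero (hQ.sub hP) ?_ ?_ ht
    · have := hcP.aestronglyMeasurable (μ := volume)
      exact (this.mul hS).mul this
    · intro s hs
      have h := (hSpos s).mul_mul_conjTranspose_same (c s • P s)
      have h' : (c s • P s)ᴴ = c s • P s := by
        rw [conjTranspose_eq_transpose_of_trivial, transpose_smul, (hPsymm s hs).eq]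
      rwa [h'] at h
    · intro s hs
      rw [IsSymm, transpose_sub, (hPsymm s hs).eq, (hQsymm s hs).eq]
    · intro t ht
      rw [hQeq t ht.2, hPeq t ht.2, add_sub_add_left_eq_sub, zero_add,
        ← integral_sub (hQint.mono_set (hsub ht)) (hPint.mono_set (hsub ht))]
      congr 1
      ext1 s
      simp only [mul_sub, sub_mul]
      abel
  have hQbd : ∀ t ∈ Set.Icc 0 T, ‖Q t‖ ≤ R₀ := fun t ht => by
    have hcont : Continuous fun s => ‖Q s‖ := hQ.norm
    have h := le_mul_exp_of_le_add_mul_integral (u := fun s => ‖Q s‖) (c := ‖H‖ + m * T)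
      (K := 2 * a) (by positivity) hcont.continuousOn (fun t ht => by
        rw [hQeq t ht.2]
        have hi : ‖∫ s in t..T, ((A s)ᵀ * Q s + Q s * A s + M s)‖ ≤
            ∫ s in t..T, (2 * a * ‖Q s‖ + m) :=
          norm_integral_le_of_norm_le ht.2 (Filter.Eventually.of_forall fun s _ =>
            (norm_add_le _ _).trans (add_le_add (norm_lyapunov_le (hAbd s)) (hMbd s)))
            (Continuous.intervalIntegrable (by fun_prop) _ _)
        rw [intervalIntegral.integral_add (Continuous.intervalIntegrable (by fun_prop) _ _)
          intervalIntegrable_const, intervalIntegral.integral_const_mul,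
          intervalIntegral.integral_const, smul_eq_mul] at hi
        have h2 : (T - t) * m ≤ m * T := by nlinarith [ht.1]
        have h3 := norm_add_le H (∫ s in t..T, ((A s)ᵀ * Q s + Q s * A s + M s))
        linarith) ht
    refine h.trans ?_
    rw [mul_comm, hR₀]
    gcongr
    linarith [ht.1]
  have hPbd : ∀ t ∈ Set.Icc 0 T, ‖P t‖ ≤ R₀ := fun t ht =>
    ((hPpos t ht).frobenius_norm_le_of_sub (hQPpos t ht)).trans (hQbd t ht)
  refine ⟨P, hP, hPpos, hPbd, fun t ht => ?_⟩
  rw [hPeq t ht.2]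
  congr 1
  refine integral_congr fun s hs => ?_
  rw [Set.uIcc_of_le ht.2] at hs
  have h1 : R / max R ‖P s‖ = 1 := by
    rw [max_eq_left ((hPbd s ⟨ht.1.trans hs.1, hs.2⟩).trans (by linarith)), div_self hR.ne']
  simp only [h1, one_smul]

theorem riccati_solution_unique {n : ℕ} {T a m σ : ℝ} (hT : 0 ≤ T)
    {A M S P Q : ℝ → Matrix (Fin n) (Fin n) ℝ} {H : Matrix (Fin n) (Fin n) ℝ}
    (hA : AEStronglyMeasurable A volume) (hM : AEStronglyMeasurable M volume)
    (hS : AEStronglyMeasurable S volume) (hAbd : ∀ s, ‖A s‖ ≤ a) (hMbd : ∀ s, ‖M s‖ ≤ m)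
    (hSbd : ∀ s, ‖S s‖ ≤ σ) (hP : ContinuousOn P (Set.Icc 0 T)) (hQ : ContinuousOn Q (Set.Icc 0 T))
    (hPeq : ∀ t ∈ Set.Icc 0 T, P t = H + ∫ s in t..T, ((A s)ᵀ * P s + P s * A s + M s -
      P s * S s * P s))
    (hQeq : ∀ t ∈ Set.Icc 0 T, Q t = H + ∫ s in t..T, ((A s)ᵀ * Q s + Q s * A s + M s -
      Q s * S s * Q s)) :
    Set.EqOn P Q (Set.Icc 0 T) := by
  obtain ⟨p, hp⟩ := isCompact_Icc.exists_bound_of_continuousOn hP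
  obtain ⟨q, hq⟩ := isCompact_Icc.exists_bound_of_continuousOn hQ
  have ha : 0 ≤ a := (norm_nonneg _).trans (hAbd 0)
  have hσ : 0 ≤ σ := (norm_nonneg _).trans (hSbd 0)
  have hr : 0 ≤ max p q :=
    le_max_of_le_left ((norm_nonneg _).trans (hp 0 ⟨le_rfl, hT⟩))
  refine eqOn_of_eq_integral_of_norm_sub_le (K := 2 * a + 2 * (σ * max p q)) (by positivity) hP hQ
    (intervalIntegrable_riccati hT hA hM hS hAbd hMbd hSbd hP hP)
    (intervalIntegrable_riccati hT hA hM hS hAbd hMbd hSbd hQ hQ) hPeq hQeq fun s hs => ?_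
  have heq : ((A s)ᵀ * P s + P s * A s + M s - P s * S s * P s) -
      ((A s)ᵀ * Q s + Q s * A s + M s - Q s * S s * Q s) =
      ((A s)ᵀ * (P s - Q s) + (P s - Q s) * A s) - (P s * S s * P s - Q s * S s * Q s) := by
    simp only [mul_sub, sub_mul]
    abel
  rw [heq, add_mul]
  exact (norm_sub_le _ _).trans (add_le_add (norm_lyapunov_le (hAbd s))
    (norm_quadratic_sub_le (hSbd s) ((hp s hs).trans (le_max_left _ _))
      ((hq s hs).trans (le_max_right _ _))))

end MatrixEquations

theorem aestronglyMeasurable_indicator_quadratic {n k d : ℕ} {I : Set ℝ} (hI : MeasurableSet I)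
    {B : ℝ → Matrix (Fin n) (Fin k) ℝ} {N : ℝ → Matrix (Fin k) (Fin k) ℝ}
    {Sg : ℝ → Matrix (Fin n) (Fin d) ℝ} {Γ : Matrix (Fin d) (Fin d) ℝ}
    (hB : StronglyMeasurable B) (hN : StronglyMeasurable N) (hSg : ContinuousOn Sg I) :
    AEStronglyMeasurable
      (I.indicator fun s => B s * (N s)⁻¹ * (B s)ᵀ - (2 : ℝ) • (Sg s * Γ * (Sg s)ᵀ)) volume := by
  rw [aestronglyMeasurable_indicator_iff hI]
  have hdet : StronglyMeasurable fun s => (N s).det :=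
    (continuous_id.matrix_det).comp_stronglyMeasurable hN
  have hadj : StronglyMeasurable fun s => (N s).adjugate :=
    (continuous_id.matrix_adjugate).comp_stronglyMeasurable hN
  have hinv : StronglyMeasurable fun s => (N s)⁻¹ := by
    simp only [inv_def, Ring.inverse_eq_inv']
    exact hdet.measurable.inv.stronglyMeasurable.smul hadj
  have hBNB : StronglyMeasurable fun s => B s * (N s)⁻¹ * (B s)ᵀ := by
    have hc : Continuous fun p : Matrix (Fin n) (Fin k) ℝ × Matrix (Fin k) (Fin k) ℝ =>
        p.1 * p.2 * p.1ᵀ :=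
      (continuous_fst.matrix_mul continuous_snd).matrix_mul continuous_fst.matrix_transpose
    exact hc.comp_stronglyMeasurable (hB.prodMk hinv)
  have hΓ : ContinuousOn (fun s => (2 : ℝ) • (Sg s * Γ * (Sg s)ᵀ)) I := by
    have hc : Continuous fun X : Matrix (Fin n) (Fin d) ℝ => X * Γ * Xᵀ :=
      (continuous_id.matrix_mul continuous_const).matrix_mul continuous_id.matrix_transpose
    exact (continuousOn_const (c := (2 : ℝ))).smul (hc.comp_continuousOn hSg)
  have : TopologicalSpace.PseudoMetrizableSpace (Matrix (Fin n) (Fin n) ℝ) :=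
    inferInstanceAs (TopologicalSpace.PseudoMetrizableSpace (Fin n → Fin n → ℝ))
  exact hBNB.aestronglyMeasurable.restrict.sub (hΓ.aestronglyMeasurable hI)

theorem continuousOn_matrix_inv {k : ℕ} {I : Set ℝ} {N : ℝ → Matrix (Fin k) (Fin k) ℝ}
    (hN : ContinuousOn N I) (hdet : ∀ t ∈ I, (N t).det ≠ 0) :
    ContinuousOn (fun t => (N t)⁻¹) I := by
  simp only [inv_def, Ring.inverse_eq_inv']
  exact ((continuous_id.matrix_det.comp_continuousOn hN).inv₀ hdet).smul
    (continuous_id.matrix_adjugate.comp_continuousOn hN)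

theorem Matrix.PosSemidef.det_ne_zero_of_sub_smul_one {k : ℕ} {N : Matrix (Fin k) (Fin k) ℝ}
    {δ : ℝ} (hδ : 0 < δ) (hN : (N - δ • (1 : Matrix (Fin k) (Fin k) ℝ)).PosSemidef) :
    N.det ≠ 0 := by
  have h : N.PosDef := by
    have := PosDef.posSemidef_add hN
      (PosDef.one.smul hδ : (δ • (1 : Matrix (Fin k) (Fin k) ℝ)).PosDef)
    rwa [sub_add_cancel] at this
  exact h.det_pos.ne'

theorem exists_bound_quadratic {n k d : ℕ} {T : ℝ}
    {B : ℝ → Matrix (Fin n) (Fin k) ℝ} {N : ℝ → Matrix (Fin k) (Fin k) ℝ}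
    {Sg : ℝ → Matrix (Fin n) (Fin d) ℝ} {Γ : Matrix (Fin d) (Fin d) ℝ}
    (hB : ∃ C, ∀ t ∈ Set.Icc (0 : ℝ) T, ‖B t‖ ≤ C)
    (hNcont : ContinuousOn N (Set.Icc 0 T)) (hdet : ∀ t ∈ Set.Icc 0 T, (N t).det ≠ 0)
    (hSg : ContinuousOn Sg (Set.Icc 0 T)) :
    ∃ σ, ∀ t ∈ Set.Icc 0 T,
      ‖B t * (N t)⁻¹ * (B t)ᵀ - (2 : ℝ) • (Sg t * Γ * (Sg t)ᵀ)‖ ≤ σ := by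
  obtain ⟨b, hb⟩ := hB
  obtain ⟨ν, hν⟩ := isCompact_Icc.exists_bound_of_continuousOn
    (continuousOn_matrix_inv hNcont hdet)
  obtain ⟨g, hg⟩ := isCompact_Icc.exists_bound_of_continuousOn hSg
  refine ⟨b * ν * b + 2 * (g * ‖Γ‖ * g), fun t ht => ?_⟩
  have hb0 : 0 ≤ b := (norm_nonneg _).trans (hb t ht)
  have hν0 : 0 ≤ ν := (norm_nonneg _).trans (hν t ht)
  have hg0 : 0 ≤ g := (norm_nonneg _).trans (hg t ht)
  refine (norm_sub_le _ _).trans (add_le_add ?_ ?_)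
  · refine (frobenius_norm_mul _ _).trans (mul_le_mul ((frobenius_norm_mul _ _).trans
      (mul_le_mul (hb t ht) (hν t ht) (norm_nonneg _) hb0)) ?_ (norm_nonneg _) (by positivity))
    rw [frobenius_norm_transpose]
    exact hb t ht
  · rw [norm_smul, Real.norm_of_nonneg zero_le_two]
    refine mul_le_mul_of_nonneg_left ?_ zero_le_two
    refine (frobenius_norm_mul _ _).trans (mul_le_mul ((frobenius_norm_mul _ _).trans
      (mul_le_mul_of_nonneg_right (hg t ht) (norm_nonneg _))) ?_ (norm_nonneg _) (by positivity))
    rw [frobenius_norm_transpose]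
    exact hg t ht

theorem norm_indicator_le_sSup {E : Type*} [NormedAddCommGroup E] {I : Set ℝ} {f : ℝ → E}
    (hf : ∃ C, ∀ t ∈ I, ‖f t‖ ≤ C) (s : ℝ) :
    ‖I.indicator f s‖ ≤ sSup ((fun s => ‖f s‖) '' I) := by
  obtain ⟨C, hC⟩ := hf
  by_cases hs : s ∈ I
  · rw [Set.indicator_of_mem hs]
    exact le_csSup ⟨C, by rintro _ ⟨t, ht, rfl⟩; exact hC t ht⟩ ⟨s, hs, rfl⟩
  · rw [Set.indicator_of_notMem hs, norm_zero]
    exact Real.sSup_nonneg (by rintro _ ⟨t, -, rfl⟩; exact norm_nonneg _)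

theorem Matrix.PosSemidef.indicator {n : ℕ} {I : Set ℝ} {f : ℝ → Matrix (Fin n) (Fin n) ℝ}
    (hf : ∀ t ∈ I, (f t).PosSemidef) (s : ℝ) : (I.indicator f s).PosSemidef := by
  by_cases hs : s ∈ I
  · rw [Set.indicator_of_mem hs]
    exact hf s hs
  · rw [Set.indicator_of_notMem hs]
    exact .zero

/-- under continuity of `Σ` (denoted `Sg`) and `N` on `[0,T]` and negative
definiteness of `2Σ(t)ΓΣ(t)ᵀ − B(t)N(t)⁻¹B(t)ᵀ`, the Riccati terminal value problem
`P(t) = H + ∫_t^T [A(s)ᵀP(s) + P(s)A(s) + M(s) + P(s)(2Σ(s)ΓΣ(s)ᵀ − B(s)N(s)⁻¹B(s)ᵀ)P(s)] ds`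
has a unique continuous symmetric solution on `[0,T]`; it is positive semidefinite and
satisfies `sup_{t∈[0,T]} ‖P(t)‖ ≤ e^{2‖A‖_∞ T} (‖H‖ + ‖M‖_∞ T)` (Frobenius norms). -/
theorem riccati_terminal_value_problem {n k d : ℕ} (T : ℝ) (hT : 0 < T)
    (A : ℝ → Matrix (Fin n) (Fin n) ℝ) (B : ℝ → Matrix (Fin n) (Fin k) ℝ)
    (M : ℝ → Matrix (Fin n) (Fin n) ℝ) (N : ℝ → Matrix (Fin k) (Fin k) ℝ)
    (Sg : ℝ → Matrix (Fin n) (Fin d) ℝ)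
    (Γ : Matrix (Fin d) (Fin d) ℝ) (H : Matrix (Fin n) (Fin n) ℝ) (δ : ℝ)
    -- boundedness and measurability of the coefficients
    (hAmeas : StronglyMeasurable A) (hBmeas : StronglyMeasurable B)
    (hMmeas : StronglyMeasurable M) (hNmeas : StronglyMeasurable N)
    (hAbd : ∃ C, ∀ t ∈ Set.Icc (0 : ℝ) T, ‖A t‖ ≤ C)
    (hBbd : ∃ C, ∀ t ∈ Set.Icc (0 : ℝ) T, ‖B t‖ ≤ C)
    (hMbd : ∃ C, ∀ t ∈ Set.Icc (0 : ℝ) T, ‖M t‖ ≤ C)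
    (hNbd : ∃ C, ∀ t ∈ Set.Icc (0 : ℝ) T, ‖N t‖ ≤ C)
    -- symmetry and (semi)definiteness assumptions
    (hMsymm : ∀ t ∈ Set.Icc (0 : ℝ) T, (M t).IsSymm)
    (hMpos : ∀ t ∈ Set.Icc (0 : ℝ) T, (M t).PosSemidef)
    (hNsymm : ∀ t ∈ Set.Icc (0 : ℝ) T, (N t).IsSymm)
    (hδ : 0 < δ)
    (hNδ : ∀ t ∈ Set.Icc (0 : ℝ) T, (N t - δ • (1 : Matrix (Fin k) (Fin k) ℝ)).PosSemidef)
    (hΓsymm : Γ.IsSymm) (hΓ : Γ.PosDef)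
    (hHsymm : H.IsSymm) (hH : H.PosSemidef)
    -- continuity of Σ and N on [0,T]
    (hSgcont : ContinuousOn Sg (Set.Icc 0 T)) (hNcont : ContinuousOn N (Set.Icc 0 T))
    -- 2Σ(t)ΓΣ(t)ᵀ − B(t)N(t)⁻¹B(t)ᵀ is negative definite on [0,T]
    (hneg : ∀ t ∈ Set.Icc (0 : ℝ) T,
      (B t * (N t)⁻¹ * (B t)ᵀ - (2 : ℝ) • (Sg t * Γ * (Sg t)ᵀ)).PosDef) :
    ∃ P : ℝ → Matrix (Fin n) (Fin n) ℝ,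
      -- existence: a continuous, symmetric-valued solution of the integral equation
      (ContinuousOn P (Set.Icc 0 T) ∧ (∀ t ∈ Set.Icc (0 : ℝ) T, (P t).IsSymm) ∧
        ∀ t ∈ Set.Icc (0 : ℝ) T,
          P t = H + ∫ s in t..T, ((A s)ᵀ * P s + P s * A s + M s +
            P s * ((2 : ℝ) • (Sg s * Γ * (Sg s)ᵀ) - B s * (N s)⁻¹ * (B s)ᵀ) * P s)) ∧
      -- uniqueness among such solutions, on [0,T]
      (∀ Q : ℝ → Matrix (Fin n) (Fin n) ℝ,
        (ContinuousOn Q (Set.Icc 0 T) ∧ (∀ t ∈ Set.Icc (0 : ℝ) T, (Q t).IsSymm) ∧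
          ∀ t ∈ Set.Icc (0 : ℝ) T,
            Q t = H + ∫ s in t..T, ((A s)ᵀ * Q s + Q s * A s + M s +
              Q s * ((2 : ℝ) • (Sg s * Γ * (Sg s)ᵀ) - B s * (N s)⁻¹ * (B s)ᵀ) * Q s)) →
        ∀ t ∈ Set.Icc (0 : ℝ) T, Q t = P t) ∧
      -- positive semidefiniteness
      (∀ t ∈ Set.Icc (0 : ℝ) T, (P t).PosSemidef) ∧
      -- the norm bound with sup norms over [0,T]
      (∀ t ∈ Set.Icc (0 : ℝ) T,
        ‖P t‖ ≤ Real.exp (2 * sSup ((fun s => ‖A s‖) '' Set.Icc 0 T) * T) *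
          (‖H‖ + sSup ((fun s => ‖M s‖) '' Set.Icc 0 T) * T)) := by
  set I := Set.Icc (0 : ℝ) T
  set S : ℝ → Matrix (Fin n) (Fin n) ℝ := fun s =>
    B s * (N s)⁻¹ * (B s)ᵀ - (2 : ℝ) • (Sg s * Γ * (Sg s)ᵀ) with hSdef
  have hImeas : MeasurableSet I := measurableSet_Icc
  have hSbd : ∃ σ, ∀ t ∈ I, ‖S t‖ ≤ σ := exists_bound_quadratic hBbd hNcont
    (fun t ht => (hNδ t ht).det_ne_zero_of_sub_smul_one hδ) hSgcont
  have hA' : AEStronglyMeasurable (I.indicator A) volume :=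
    (hAmeas.indicator hImeas).aestronglyMeasurable
  have hM' : AEStronglyMeasurable (I.indicator M) volume :=
    (hMmeas.indicator hImeas).aestronglyMeasurable
  have hS' : AEStronglyMeasurable (I.indicator S) volume :=
    aestronglyMeasurable_indicator_quadratic hImeas hBmeas hNmeas hSgcont
  have hint : ∀ (X : ℝ → Matrix (Fin n) (Fin n) ℝ), ∀ t ∈ I,
      (∫ s in t..T, ((A s)ᵀ * X s + X s * A s + M s +
        X s * ((2 : ℝ) • (Sg s * Γ * (Sg s)ᵀ) - B s * (N s)⁻¹ * (B s)ᵀ) * X s)) =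
      ∫ s in t..T, ((I.indicator A s)ᵀ * X s + X s * I.indicator A s + I.indicator M s -
        X s * I.indicator S s * X s) := by
    intro X t ht
    refine integral_congr fun s hs => ?_
    rw [Set.uIcc_of_le ht.2] at hs
    have hsI : s ∈ I := ⟨ht.1.trans hs.1, hs.2⟩
    simp only [Set.indicator_of_mem hsI, hSdef]
    rw [← neg_sub (B s * (N s)⁻¹ * (B s)ᵀ), mul_neg, neg_mul, ← sub_eq_add_neg]
  obtain ⟨P, hP, hPpos, hPbd, hPeq⟩ := exists_riccati_solution hT.le hA' hM' hS'
    (norm_indicator_le_sSup hAbd) (norm_indicator_le_sSup hMbd) (norm_indicator_le_sSup hSbd)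
    (PosSemidef.indicator hMpos) (PosSemidef.indicator fun t ht => (hneg t ht).posSemidef) hH
  refine ⟨P, ⟨Continuous.continuousOn hP, fun t ht => by
    simpa [IsSymm, IsHermitian] using (hPpos t ht).1, fun t ht => ?_⟩, ?_, hPpos, hPbd⟩
  · rw [hint P t ht]
    exact hPeq t ht
  · rintro Q ⟨hQ, -, hQeq⟩ t ht
    refine riccati_solution_unique hT.le hA' hM' hS'
      (norm_indicator_le_sSup hAbd) (norm_indicator_le_sSup hMbd) (norm_indicator_le_sSup hSbd)
      hQ (Continuous.continuousOn hP) (fun t ht => ?_) hPeq ht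
    rw [hQeq t ht, hint Q t ht]
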